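/- arXiv:1011.5469 — 3 statements merged into one kernel-verified Lean document; each statement's English description precedes it below -/
import Mathlib

section
/- Detailed balance for the expanded Markov chain (step in the proof of the paper's Theorem 3): let R be a symmetric relation on C, W : C × C → ℝ a symmetric function, τ > 0 and B_max ≥ 0. For each c ∈ C let n_c ≥ 1 be an integer and ρ(c,k) ≥ 0 for k = 0,1,…,n_c. The expanded states are pairs (c,k) with c ∈ C and 0 ≤ k ≤ n_c, with energies E(c,k) = U(c) + k·B_max/n_c, and transition rates q̄((c,k),(c',k')) = τ·ρ(c',k') / exp(κ(U(c) − W(c,c') + k·B_max/n_c)) if R c c' holds, and 0 otherwise. Then the distribution π(c,k) = ρ(c,k)·exp(κE(c,k)) / Z, where Z = ∑_{c'∈C} ∑_{k'=0}^{n_{c'}} ρ(c',k')·exp(κE(c',k')) (assumed positive), satisfies the detailed balance equations π(c,k)·q̄((c,k),(c',k')) = π(c',k')·q̄((c',k'),(c,k)) for all expanded states (c,k), (c',k'). -/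
open Real Finset

/-- Detailed balance for the expanded Markov chain (step in the proof of the paper's
Theorem 3). Expanded states are pairs `(c,k)` with `0 ≤ k ≤ n_c`, energies
`E(c,k) = U(c) + k·B_max/n_c`, and transition rates
`q̄((c,k),(c',k')) = τ·ρ(c',k') / exp(κ(U(c) − W(c,c') + k·B_max/n_c))` when `R c c'`
holds (`0` otherwise). The distribution `pdist(c,k) = ρ(c,k)·exp(κE(c,k))/Z` satisfies
the detailed balance equations. -/
theorem expanded_chain_detailed_balance
    {C : Type*} [Fintype C] [Nonempty C] (U : C → ℝ) (κ : ℝ) (hκ : 0 < κ)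
    (R : C → C → Prop) [DecidableRel R] (hR : ∀ c c', R c c' ↔ R c' c)
    (W : C → C → ℝ) (hW : ∀ c c', W c c' = W c' c)
    (τ : ℝ) (hτ : 0 < τ) (Bmax : ℝ) (hBmax : 0 ≤ Bmax)
    (n : C → ℕ) (hn : ∀ c, 1 ≤ n c)
    (ρ : C → ℕ → ℝ) (hρ : ∀ c k, k ≤ n c → 0 ≤ ρ c k)
    (En : C → ℕ → ℝ) (hEn : ∀ c k, En c k = U c + (k : ℝ) * Bmax / (n c : ℝ))
    (q : C → ℕ → C → ℕ → ℝ)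
    (hq : ∀ c k c' k', q c k c' k' =
      if R c c' then
        τ * ρ c' k' / exp (κ * (U c - W c c' + (k : ℝ) * Bmax / (n c : ℝ)))
      else 0)
    (Z : ℝ)
    (hZ : Z = ∑ c : C, ∑ k ∈ Finset.range (n c + 1), ρ c k * exp (κ * En c k))
    (hZpos : 0 < Z)
    (pdist : C → ℕ → ℝ) (hpdist : ∀ c k, pdist c k = ρ c k * exp (κ * En c k) / Z) :
    ∀ (c : C) (k : ℕ) (c' : C) (k' : ℕ), k ≤ n c → k' ≤ n c' →
      pdist c k * q c k c' k' = pdist c' k' * q c' k' c k := by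
  intro c k c' k' _ _
  have flow : ∀ a i b j, R a b →
      pdist a i * q a i b j = ρ a i * ρ b j * τ * exp (κ * W a b) / Z := by
    intro a i b j hab
    have hexp : exp (κ * En a i) =
        exp (κ * (U a - W a b + (i : ℝ) * Bmax / (n a : ℝ))) * exp (κ * W a b) := by
      rw [← exp_add, hEn]
      congr 1
      ring
    rw [hpdist, hq, if_pos hab, hexp]
    field_simp
  by_cases h : R c c'
  · rw [flow c k c' k' h, flow c' k' c k ((hR c c').1 h), hW c c']
    ring
  · rw [hq c k, hq c' k', if_neg h, if_neg (fun h' => h ((hR c c').2 h')), mul_zero, mul_zero]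
end

section
/- Total variation bound between the perturbed stationary distribution and the Gibbs distribution: let σ : C → ℝ satisfy 1 ≤ σ_c ≤ exp(κ·B_max) for all c ∈ C, and define p(c) = σ_c·exp(κU(c)) / ∑_{c'∈C} σ_{c'}·exp(κU(c')) and the Gibbs distribution p*(c) = exp(κU(c)) / ∑_{c'∈C} exp(κU(c')). Then ∑_{c∈C} max(p*(c) − p(c), 0) ≤ 1 − exp(−κ·B_max); equivalently, the total variational distance d_TV(p*, p) = sup_{A⊆C} |p*(A) − p(A)| is at most 1 − exp(−κ·B_max). -/
open Real Finset

/-- If `q` dominates `a • r` pointwise with `r ≥ 0` of total mass one, the positive part of `r - q`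
has mass at most `1 - a`. -/
theorem sum_max_sub_le_one_sub {C : Type*} [Fintype C] {q r : C → ℝ} {a : ℝ} (ha : a ≤ 1)
    (hr : ∀ c, 0 ≤ r c) (hr1 : ∑ c, r c = 1) (hqr : ∀ c, a * r c ≤ q c) :
    ∑ c, max (r c - q c) 0 ≤ 1 - a := by
  calc ∑ c, max (r c - q c) 0 ≤ ∑ c, (1 - a) * r c := by
        refine Finset.sum_le_sum fun c _ => max_le ?_ (mul_nonneg (sub_nonneg.2 ha) (hr c))
        linarith [hqr c]
    _ = 1 - a := by rw [← Finset.mul_sum, hr1, mul_one]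

/-- For functions of equal total mass, the discrepancy on any set is bounded by the mass of the
positive part of the difference. -/
theorem abs_sum_sub_sum_le_sum_max {C : Type*} [Fintype C] {q r : C → ℝ}
    (h : ∑ c, r c = ∑ c, q c) (A : Finset C) :
    |(∑ c ∈ A, r c) - ∑ c ∈ A, q c| ≤ ∑ c, max (r c - q c) 0 := by
  classical
  have key (B : Finset C) : (∑ c ∈ B, r c) - ∑ c ∈ B, q c ≤ ∑ c, max (r c - q c) 0 := by
    rw [← Finset.sum_sub_distrib]
    exact (Finset.sum_le_sum fun c _ => le_max_left _ 0).trans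
      (Finset.sum_le_sum_of_subset_of_nonneg (Finset.subset_univ B) fun c _ _ => le_max_right _ _)
  refine abs_le.2 ⟨?_, key A⟩
  linarith [key Aᶜ, Finset.sum_add_sum_compl A r, Finset.sum_add_sum_compl A q]

/-- Reweighting positive weights by factors in `[1, M]` decreases each normalized weight by a factor
of at most `M`. -/
theorem inv_mul_div_sum_le_mul_div_sum {C : Type*} [Fintype C] [Nonempty C] {w σ : C → ℝ} {M : ℝ}
    (hw : ∀ c, 0 < w c) (hσ : ∀ c, 1 ≤ σ c ∧ σ c ≤ M) (c : C) :
    M⁻¹ * (w c / ∑ c', w c') ≤ σ c * w c / ∑ c', σ c' * w c' := by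
  have hpos : 0 < ∑ c', σ c' * w c' := Finset.sum_pos
    (fun c _ => mul_pos (zero_lt_one.trans_le (hσ c).1) (hw c)) Finset.univ_nonempty
  have hle : ∑ c', σ c' * w c' ≤ M * ∑ c', w c' := by
    rw [Finset.mul_sum]
    exact Finset.sum_le_sum fun c _ => mul_le_mul_of_nonneg_right (hσ c).2 (hw c).le
  calc M⁻¹ * (w c / ∑ c', w c') = w c / (M * ∑ c', w c') := by
        rw [div_eq_mul_inv, div_eq_mul_inv, mul_inv]; ring
    _ ≤ σ c * w c / ∑ c', σ c' * w c' :=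
        div_le_div₀ (mul_nonneg (zero_le_one.trans (hσ c).1) (hw c).le)
          (le_mul_of_one_le_left (hw c).le (hσ c).1) hpos hle

/-- Total variation bound between the perturbed stationary distribution and the
Gibbs distribution: if `1 ≤ σ_c ≤ exp(κB_max)` for all `c`, then
`∑_c max(p*(c) − p(c), 0) ≤ 1 − exp(−κB_max)`; equivalently, the total variational
distance `sup_{A⊆C} |p*(A) − p(A)|` is at most `1 − exp(−κB_max)`. -/
theorem tv_distance_bound_perturbed_gibbs
    {C : Type*} [Fintype C] [Nonempty C] (U : C → ℝ) (κ : ℝ) (hκ : 0 < κ)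
    (Bmax : ℝ) (hBmax : 0 ≤ Bmax)
    (σ : C → ℝ) (hσ : ∀ c, 1 ≤ σ c ∧ σ c ≤ exp (κ * Bmax))
    (p pstar : C → ℝ)
    (hp : ∀ c, p c = σ c * exp (κ * U c) / ∑ c' : C, σ c' * exp (κ * U c'))
    (hpstar : ∀ c, pstar c = exp (κ * U c) / ∑ c' : C, exp (κ * U c')) :
    (∑ c : C, max (pstar c - p c) 0 ≤ 1 - exp (-(κ * Bmax))) ∧
    ∀ A : Finset C, |(∑ c ∈ A, pstar c) - ∑ c ∈ A, p c| ≤ 1 - exp (-(κ * Bmax)) := by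
  have hw (c : C) : 0 < exp (κ * U c) := exp_pos _
  have hpstar1 : ∑ c, pstar c = 1 := by
    simp_rw [hpstar]
    rw [← Finset.sum_div]
    exact div_self (Finset.sum_pos (fun c _ => hw c) Finset.univ_nonempty).ne'
  have hp1 : ∑ c, p c = 1 := by
    simp_rw [hp]
    rw [← Finset.sum_div]
    exact div_self (Finset.sum_pos
      (fun c _ => mul_pos (zero_lt_one.trans_le (hσ c).1) (hw c)) Finset.univ_nonempty).ne'
  have hsum : ∑ c, max (pstar c - p c) 0 ≤ 1 - exp (-(κ * Bmax)) := by
    refine sum_max_sub_le_one_sub (exp_le_one_iff.2 (neg_nonpos.2 (mul_nonneg hκ.le hBmax)))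
      (fun c => ?_) hpstar1 fun c => ?_
    · rw [hpstar]
      exact div_nonneg (hw c).le (Finset.sum_nonneg fun c _ => (hw c).le)
    · rw [hpstar, hp, exp_neg]
      exact inv_mul_div_sum_le_mul_div_sum hw hσ c
  exact ⟨hsum, fun A => (abs_sum_sub_sum_le_sum_max (hpstar1.trans hp1.symm) A).trans hsum⟩
end

section
/- Lyapunov descent inequality for the primal-dual storage and bandwidth allocation dynamics (the key inequality V̇(y) ≤ 0 in the proof of the paper's Theorem 1): suppose (x*, f*, λ*, μ*, k*) is a KKT point, i.e., it is feasible and satisfies (i) primal feasibility: x*_{ji} ≤ f*_{j,v(i)}·r(v(i)) for all (j,i) ∈ E, ∑_{i:(j,i)∈E} x*_{ji} ≤ B(j) for all j, and ∑_{m∈M} f*_{jm}·Vs(m) ≤ S(j) for all j; (ii) (g_{ji}(x*) − (λ*_j + k*_{ji}))_{x*_{ji}}^{[0,∞)} = 0 for all (j,i) ∈ E; (iii) (r(m)·∑_{i:(j,i)∈E, v(i)=m} k*_{ji} − μ*_j·Vs(m))_{f*_{jm}}^{[0,1]} = 0 for all j ∈ J, m ∈ M; (iv) λ*_j·(∑_{i:(j,i)∈E}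 x*_{ji} − B(j)) = 0 for all j; (v) μ*_j·(∑_{m∈M} f*_{jm}·Vs(m) − S(j)) = 0 for all j; (vi) k*_{ji}·(x*_{ji} − f*_{j,v(i)}·r(v(i))) = 0 for all (j,i) ∈ E. Then for every feasible tuple (x, f, λ, μ, k), the following sum is nonpositive: ∑_{(j,i)∈E} (x_{ji} − x*_{ji})·(g_{ji}(x) − (λ_j + k_{ji}))_{x_{ji}}^{[0,∞)} + ∑_{j∈J, m∈M} (f_{jm} − f*_{jm})·(r(m)·∑_{i:(j,i)∈E, v(i)=m} k_{ji} − μ_j·Vs(m))_{f_{jm}}^{[0,1]} + ∑_{j∈J} (λ_j − λ*_j)·(∑_{i:(j,i)∈E} x_{ji} − B(j))_{λ_j}^{[0,∞)} + ∑_{j∈J} (μ_j − μ*_j)·(∑_{m∈M} f_{jm}·Vs(m) − S(j))_{μ_j}^{[0,∞)} + ∑_{(j,i)∈E} (k_{ji} − k*_{ji})·(x_{ji} − f_{j,v(i)}·r(v(i)))_{k_{ji}}^{[0,∞)} ≤ 0. -/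
open Finset

/-- The projection of `h` at the point `y` relative to the interval `[a,b]`:
`min(0,h)` if `y ≥ b`, `max(0,h)` if `y ≤ a`, and `h` if `a < y < b`. -/
noncomputable def projInterval (a b y h : ℝ) : ℝ :=
  if b ≤ y then min 0 h else if y ≤ a then max 0 h else h

/-- The projection of `h` at the point `y` relative to the half-line `[0,∞)`:
`max(0,h)` if `y ≤ 0`, and `h` if `y > 0`. -/
noncomputable def projHalfLine (y h : ℝ) : ℝ :=
  if y ≤ 0 then max 0 h else h

theorem mul_projHalfLine_le {z : ℝ} (y h : ℝ) (hz : 0 ≤ z) :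
    (y - z) * projHalfLine y h ≤ (y - z) * h := by
  unfold projHalfLine
  split_ifs with h0
  · exact mul_le_mul_of_nonpos_left (le_max_right _ _) (by linarith)
  · exact le_rfl

theorem mul_projInterval_le {a b z : ℝ} (y h : ℝ) (hz : a ≤ z ∧ z ≤ b) :
    (y - z) * projInterval a b y h ≤ (y - z) * h := by
  unfold projInterval
  split_ifs with h0 h1
  · exact mul_le_mul_of_nonneg_left (min_le_right _ _) (by linarith [hz.2])
  · exact mul_le_mul_of_nonpos_left (le_max_right _ _) (by linarith [hz.1])
  · exact le_rfl

theorem mul_nonpos_of_projHalfLine_eq_zero {y z h : ℝ} (hy : 0 ≤ y)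
    (h0 : projHalfLine z h = 0) : (y - z) * h ≤ 0 := by
  unfold projHalfLine at h0
  split_ifs at h0 with h1
  · exact mul_nonpos_of_nonneg_of_nonpos (by linarith) (by linarith [le_max_right 0 h])
  · simp [h0]

theorem mul_nonpos_of_projInterval_eq_zero {a b y z h : ℝ} (hy : a ≤ y ∧ y ≤ b)
    (h0 : projInterval a b z h = 0) : (y - z) * h ≤ 0 := by
  unfold projInterval at h0
  split_ifs at h0 with h1 h2
  · exact mul_nonpos_of_nonpos_of_nonneg (by linarith [hy.2]) (by linarith [min_le_right 0 h])
  · exact mul_nonpos_of_nonneg_of_nonpos (by linarith [hy.1]) (by linarith [le_max_right 0 h])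
  · simp [h0]

/-- A multiplier term is bounded by its linearization at a complementary pair. -/
theorem mul_projHalfLine_le_of_complementary {y z c d : ℝ} (hy : 0 ≤ y) (hz : 0 ≤ z)
    (hd : d ≤ 0) (hc : z * d = 0) :
    (y - z) * projHalfLine y c ≤ (y - z) * (c - d) := by
  have h1 := mul_projHalfLine_le y c hz
  nlinarith [mul_nonpos_of_nonneg_of_nonpos hy hd]

/-- Monotonicity of the chosen supergradient of the concave function `min · c`. -/
theorem sub_mul_ite_sub_ite_nonpos (a b c : ℝ) :
    (a - b) * ((if a < c then (1 : ℝ) else 0) - if b < c then 1 else 0) ≤ 0 := by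
  split_ifs <;> linarith

/-- Lyapunov descent inequality for the primal-dual storage and bandwidth allocation
dynamics (the key inequality `V̇(y) ≤ 0` in the proof of the paper's Theorem 1):
if `(x*, f*, λ*, μ*, k*)` is a KKT point, then for every feasible tuple
`(x, f, λ, μ, k)` the displayed sum of projected-dynamics terms is nonpositive. -/
theorem lyapunov_descent_primal_dual
    {M I J : Type*} [Fintype M] [Fintype I] [Fintype J]
    [DecidableEq M] [DecidableEq I] [DecidableEq J]
    (v : I → M) (r l : M → ℝ) (hr : ∀ m, 0 < r m) (hl : ∀ m, 0 < l m)
    (Vs : M → ℝ) (hVs : ∀ m, Vs m = r m * l m)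
    (B S : J → ℝ) (E : Finset (J × I))
    -- received rate of each user and chosen subgradient of its utility
    (recv : ((J × I) → ℝ) → I → ℝ)
    (hrecv : ∀ x i, recv x i = ∑ p ∈ E.filter (fun p => p.2 = i), x p)
    (g : ((J × I) → ℝ) → (J × I) → ℝ)
    (hg : ∀ x p, g x p = if recv x p.2 < r (v p.2) then (1 : ℝ) else 0)
    -- the KKT point (x*, f*, λ*, μ*, k*)
    (xs : (J × I) → ℝ) (fs : J → M → ℝ) (lams mus : J → ℝ) (ks : (J × I) → ℝ)
    (hxs : ∀ p, 0 ≤ xs p) (hfs : ∀ j m, 0 ≤ fs j m ∧ fs j m ≤ 1)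
    (hlams : ∀ j, 0 ≤ lams j) (hmus : ∀ j, 0 ≤ mus j) (hks : ∀ p, 0 ≤ ks p)
    -- (i) primal feasibility
    (hprimal1 : ∀ p ∈ E, xs p ≤ fs p.1 (v p.2) * r (v p.2))
    (hprimal2 : ∀ j, ∑ p ∈ E.filter (fun p => p.1 = j), xs p ≤ B j)
    (hprimal3 : ∀ j, ∑ m : M, fs j m * Vs m ≤ S j)
    -- (ii)–(vi) stationarity and complementary slackness
    (hkkt2 : ∀ p ∈ E, projHalfLine (xs p) (g xs p - (lams p.1 + ks p)) = 0)
    (hkkt3 : ∀ j m, projInterval 0 1 (fs j m)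
        (r m * (∑ p ∈ E.filter (fun p => p.1 = j ∧ v p.2 = m), ks p) - mus j * Vs m) = 0)
    (hkkt4 : ∀ j, lams j * ((∑ p ∈ E.filter (fun p => p.1 = j), xs p) - B j) = 0)
    (hkkt5 : ∀ j, mus j * ((∑ m : M, fs j m * Vs m) - S j) = 0)
    (hkkt6 : ∀ p ∈ E, ks p * (xs p - fs p.1 (v p.2) * r (v p.2)) = 0)
    -- an arbitrary feasible tuple (x, f, λ, μ, k)
    (x : (J × I) → ℝ) (f : J → M → ℝ) (lam mu : J → ℝ) (k : (J × I) → ℝ)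
    (hx : ∀ p, 0 ≤ x p) (hf : ∀ j m, 0 ≤ f j m ∧ f j m ≤ 1)
    (hlam : ∀ j, 0 ≤ lam j) (hmu : ∀ j, 0 ≤ mu j) (hk : ∀ p, 0 ≤ k p) :
    (∑ p ∈ E, (x p - xs p) * projHalfLine (x p) (g x p - (lam p.1 + k p)))
    + (∑ j : J, ∑ m : M, (f j m - fs j m) * projInterval 0 1 (f j m)
        (r m * (∑ p ∈ E.filter (fun p => p.1 = j ∧ v p.2 = m), k p) - mu j * Vs m))
    + (∑ j : J, (lam j - lams j) * projHalfLine (lam j)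
        ((∑ p ∈ E.filter (fun p => p.1 = j), x p) - B j))
    + (∑ j : J, (mu j - mus j) * projHalfLine (mu j)
        ((∑ m : M, f j m * Vs m) - S j))
    + (∑ p ∈ E, (k p - ks p) * projHalfLine (k p)
        (x p - f p.1 (v p.2) * r (v p.2)))
    ≤ 0 := by
  have hgmono : ∑ p ∈ E, (x p - xs p) * (g x p - g xs p) ≤ 0 := by
    rw [← sum_fiberwise E (fun p => p.2)]
    refine sum_nonpos fun i _ => ?_
    have : ∑ p ∈ E with p.2 = i, (x p - xs p) * (g x p - g xs p) =
        (recv x i - recv xs i) * ((if recv x i < r (v i) then (1 : ℝ) else 0)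
          - if recv xs i < r (v i) then 1 else 0) := by
      rw [hrecv x i, hrecv xs i, ← sum_sub_distrib, sum_mul, ← hrecv x i, ← hrecv xs i]
      refine sum_congr rfl fun p hp => ?_
      rw [hg, hg, (mem_filter.1 hp).2]
    rw [this]
    exact sub_mul_ite_sub_ite_nonpos _ _ _
  have hrate : ∑ p ∈ E, (x p - xs p) * projHalfLine (x p) (g x p - (lam p.1 + k p)) ≤
      -(∑ p ∈ E, (lam p.1 - lams p.1) * (x p - xs p))
        - ∑ p ∈ E, (k p - ks p) * (x p - xs p) := by
    calc _ ≤ ∑ p ∈ E, ((x p - xs p) * (g x p - g xs p)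
            - (lam p.1 - lams p.1) * (x p - xs p) - (k p - ks p) * (x p - xs p)) := by
          refine sum_le_sum fun p hp => ?_
          have h1 := mul_projHalfLine_le (x p) (g x p - (lam p.1 + k p)) (hxs p)
          have h2 := mul_nonpos_of_projHalfLine_eq_zero (hx p) (hkkt2 p hp)
          linarith
      _ ≤ _ := by
          rw [sum_sub_distrib, sum_sub_distrib]
          linarith
  have hstorage : ∑ j : J, ∑ m : M, (f j m - fs j m) * projInterval 0 1 (f j m)
        (r m * (∑ p ∈ E.filter (fun p => p.1 = j ∧ v p.2 = m), k p) - mu j * Vs m) ≤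
      (∑ p ∈ E, (k p - ks p) * ((f p.1 (v p.2) - fs p.1 (v p.2)) * r (v p.2)))
        - ∑ j : J, (mu j - mus j) * ∑ m : M, (f j m - fs j m) * Vs m := by
    have hfiber : ∑ p ∈ E, (k p - ks p) * ((f p.1 (v p.2) - fs p.1 (v p.2)) * r (v p.2)) =
        ∑ j : J, ∑ m : M, (f j m - fs j m) * (r m *
          ((∑ p ∈ E.filter (fun p => p.1 = j ∧ v p.2 = m), k p)
            - ∑ p ∈ E.filter (fun p => p.1 = j ∧ v p.2 = m), ks p)) := by
      rw [← sum_fiberwise E (fun p => p.1)]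
      refine sum_congr rfl fun j _ => ?_
      rw [← sum_fiberwise _ (fun p => v p.2)]
      refine sum_congr rfl fun m _ => ?_
      rw [filter_filter, ← sum_sub_distrib, mul_sum, mul_sum]
      refine sum_congr rfl fun p hp => ?_
      obtain ⟨-, rfl, rfl⟩ := mem_filter.1 hp
      ring
    rw [hfiber, ← sum_sub_distrib]
    refine sum_le_sum fun j _ => ?_
    rw [mul_sum, ← sum_sub_distrib]
    refine sum_le_sum fun m _ => ?_
    have h1 := mul_projInterval_le (f j m) (r m * (∑ p ∈ E.filter (fun p => p.1 = j ∧ v p.2 = m), k p)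
      - mu j * Vs m) (hfs j m)
    have h2 := mul_nonpos_of_projInterval_eq_zero (hf j m) (hkkt3 j m)
    linarith
  have hbandwidth : ∑ j : J, (lam j - lams j) * projHalfLine (lam j)
        ((∑ p ∈ E.filter (fun p => p.1 = j), x p) - B j) ≤
      ∑ p ∈ E, (lam p.1 - lams p.1) * (x p - xs p) := by
    rw [← sum_fiberwise E (fun p => p.1)]
    refine sum_le_sum fun j _ => ?_
    refine (mul_projHalfLine_le_of_complementary (hlam j) (hlams j)
      (sub_nonpos.2 (hprimal2 j)) (hkkt4 j)).trans_eq ?_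
    rw [sub_sub_sub_cancel_right, ← sum_sub_distrib, mul_sum]
    refine sum_congr rfl fun p hp => ?_
    rw [(mem_filter.1 hp).2]
  have hcapacity : ∑ j : J, (mu j - mus j) * projHalfLine (mu j)
        ((∑ m : M, f j m * Vs m) - S j) ≤
      ∑ j : J, (mu j - mus j) * ∑ m : M, (f j m - fs j m) * Vs m := by
    refine sum_le_sum fun j _ => ?_
    refine (mul_projHalfLine_le_of_complementary (hmu j) (hmus j)
      (sub_nonpos.2 (hprimal3 j)) (hkkt5 j)).trans_eq ?_
    simp only [sub_sub_sub_cancel_right, ← sum_sub_distrib, sub_mul]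
  have havailability : ∑ p ∈ E, (k p - ks p) * projHalfLine (k p)
        (x p - f p.1 (v p.2) * r (v p.2)) ≤
      (∑ p ∈ E, (k p - ks p) * (x p - xs p))
        - ∑ p ∈ E, (k p - ks p) * ((f p.1 (v p.2) - fs p.1 (v p.2)) * r (v p.2)) := by
    rw [← sum_sub_distrib]
    refine sum_le_sum fun p hp => ?_
    refine (mul_projHalfLine_le_of_complementary (hk p) (hks p)
      (sub_nonpos.2 (hprimal1 p hp)) (hkkt6 p hp)).trans_eq ?_
    ring
  linarith
end
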